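/- Let N ≥ 2 and let E ⊆ {(i,j) : 1 ≤ j < i ≤ N} be the edge set of a DAG on nodes {1,…,N} in topological order, with parents P_i = {j : (i,j) ∈ E} nonempty for every i ≥ 2, node 1 the only node without parents and node N the only node without children. For each i ∈ {2,…,N} let q_i ∈ ℝ^N satisfy q_{i,j} ≥ 0, Σ_{j ∈ P_i} q_{i,j} = 1, and q_{i,j} = 0 for j ∉ P_i. Define ē_N = 1 and, in reverse topological order for j = N−1,…,1: e_{i,j} = ē_i q_{i,j} for i ∈ C_j (the children of j, C_j = {i : (i,j) ∈ E}), and ē_j = Σ_{i ∈ C_j} e_{i,j}, with e_{i,j} = 0 for (i,j) ∉ E. Then the matrix E = (e_{i,j}) ∈ ℝ^{N×N} lies in the convex hull of the set 𝒴 of 0/1 path-indicator matrices of paths from node 1 to node N; specifically, E = Σ_{Y ∈ 𝒴} p(Y) Y where p(Y) = Π_{(i,j) edge of Y} q_{i,j} defines a probability distribution on 𝒴. -/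

import Mathlib

/-- The probability of a path `l = [y₁, …, y_L]` under the random walk with
transition probabilities `q`: the product `∏ q_{y_t, y_{t-1}}` over traversed
edges. -/
noncomputable def pathWeight {N : ℕ} (q : Fin N → Fin N → ℝ) (l : List (Fin N)) : ℝ :=
  ((l.zip l.tail).map (fun p => q p.2 p.1)).prod

/-- The `(i,j)` entry of the 0/1 indicator matrix of a path `l`:
`1` iff the edge from parent `j` to child `i` is traversed by `l`. -/
noncomputable def edgeInd {N : ℕ} (l : List (Fin N)) (i j : Fin N) : ℝ :=
  if (j, i) ∈ l.zip l.tail then 1 else 0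

/-- `l` is a path from `a` to `b` in the graph whose edges `x → y` are given by `adj y x`. -/
def IsPathFromTo {V : Type*} (adj : V → V → Prop) (a b : V) (l : List V) : Prop :=
  l.head? = some a ∧ l.getLast? = some b ∧ l.IsChain (fun x y => adj y x)

namespace IsPathFromTo

variable {V : Type*} {adj : V → V → Prop} {a b c : V} {l : List V}

theorem exists_eq_cons (h : IsPathFromTo adj a b l) : ∃ t, l = a :: t := by
  obtain ⟨h, -, -⟩ := h
  cases l with
  | nil => simp at h
  | cons x t => exact ⟨t, by simpa using h⟩

theorem cons (h : IsPathFromTo adj c b l) (hac : adj c a) : IsPathFromTo adj a b (a :: l) := by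
  obtain ⟨t, rfl⟩ := h.exists_eq_cons
  obtain ⟨-, h2, h3⟩ := h
  exact ⟨rfl, by simpa [List.getLast?_cons_cons] using h2, List.isChain_cons_cons.2 ⟨hac, h3⟩⟩

theorem exists_tail (h : IsPathFromTo adj a b l) (hab : a ≠ b) :
    ∃ c t, adj c a ∧ IsPathFromTo adj c b t ∧ l = a :: t := by
  obtain ⟨t, rfl⟩ := h.exists_eq_cons
  obtain ⟨-, h2, h3⟩ := h
  cases t with
  | nil => exact absurd (by simpa using h2) hab
  | cons c t =>
    rw [List.isChain_cons_cons] at h3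
    exact ⟨c, c :: t, h3.1, ⟨rfl, by simpa [List.getLast?_cons_cons] using h2, h3.2⟩, rfl⟩

theorem self_iff (hb : ∀ c, ¬ adj c b) : IsPathFromTo adj b b l ↔ l = [b] := by
  constructor
  · intro h
    obtain ⟨t, rfl⟩ := h.exists_eq_cons
    cases t with
    | nil => rfl
    | cons c t => exact absurd (List.isChain_cons_cons.1 h.2.2).1 (hb c)
  · rintro rfl
    exact ⟨rfl, rfl, List.isChain_singleton b⟩

theorem pairwise_lt [Preorder V] (hadj : ∀ i j, adj i j → j < i) (h : IsPathFromTo adj a b l) :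
    l.Pairwise (· < ·) :=
  List.isChain_iff_pairwise.1 (h.2.2.imp fun x y hxy => hadj y x hxy)

theorem finite [Finite V] [Preorder V] (hadj : ∀ i j, adj i j → j < i) (a b : V) :
    {l | IsPathFromTo adj a b l}.Finite := by
  have := Fintype.ofFinite V
  refine (List.finite_length_le V (Fintype.card V)).subset fun l hl => ?_
  exact List.Nodup.length_le_card ((hl.pairwise_lt hadj).imp fun h => ne_of_lt h)

/-- First-step decomposition of a sum over the paths ending at `b`. -/
theorem sum_eq [Fintype V] [DecidableRel adj] {P : V → Finset (List V)}
    (hP : ∀ a l, l ∈ P a ↔ IsPathFromTo adj a b l) (hab : a ≠ b) (f : List V → ℝ) :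
    ∑ l ∈ P a, f l = ∑ c, if adj c a then ∑ l ∈ P c, f (a :: l) else 0 := by
  classical
  have hunion : P a = (Finset.univ.filter (adj · a)).biUnion
      fun c => (P c).image (List.cons a) := by
    ext l
    simp only [Finset.mem_biUnion, Finset.mem_filter, Finset.mem_univ, true_and,
      Finset.mem_image, hP]
    constructor
    · intro h
      obtain ⟨c, t, hc, ht, rfl⟩ := h.exists_tail hab
      exact ⟨c, hc, t, ht, rfl⟩
    · rintro ⟨c, hc, t, ht, rfl⟩
      exact ht.cons hc
  rw [hunion, Finset.sum_biUnion, Finset.sum_filter]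
  · refine Finset.sum_congr rfl fun c _ => ?_
    rw [Finset.sum_image fun x _ y _ h => (List.cons.inj h).2]
  · intro c _ d _ hcd
    rw [Function.onFun, Finset.disjoint_left]
    intro l hc hd
    simp only [Finset.mem_image, hP] at hc hd
    obtain ⟨t, ht, rfl⟩ := hc
    obtain ⟨s, hs, hst⟩ := hd
    obtain rfl := (List.cons.inj hst).2
    exact hcd (Option.some.inj (ht.1.symm.trans hs.1))

end IsPathFromTo

theorem pathWeight_cons {N : ℕ} {adj : Fin N → Fin N → Prop} (q : Fin N → Fin N → ℝ)
    {a b c : Fin N} {l : List (Fin N)} (h : IsPathFromTo adj c b l) :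
    pathWeight q (a :: l) = q c a * pathWeight q l := by
  obtain ⟨t, rfl⟩ := h.exists_eq_cons
  simp [pathWeight]

theorem edgeInd_cons {N : ℕ} {adj : Fin N → Fin N → Prop} (hadj : ∀ i j, adj i j → j < i)
    {a b c : Fin N} {l : List (Fin N)} (h : IsPathFromTo adj c b l) (hac : adj c a)
    (i j : Fin N) :
    edgeInd (a :: l) i j = edgeInd l i j + if a = j ∧ c = i then 1 else 0 := by
  have hlt : ∀ x ∈ l, a < x := (List.pairwise_cons.1 ((h.cons hac).pairwise_lt hadj)).1
  obtain ⟨t, rfl⟩ := h.exists_eq_cons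
  by_cases hj : a = j
  · subst hj
    have hnot : (a, i) ∉ (c :: t).zip t := fun hmem =>
      lt_irrefl a (hlt a (List.of_mem_zip hmem).1)
    simp [edgeInd, hnot, eq_comm]
  · by_cases hm : (j, i) ∈ (c :: t).zip t <;> simp [edgeInd, hj, Ne.symm hj, hm]

theorem pathWeight_nonneg {N : ℕ} {adj : Fin N → Fin N → Prop} {q : Fin N → Fin N → ℝ}
    (hq : ∀ i j, adj i j → 0 ≤ q i j) {l : List (Fin N)}
    (h : l.IsChain (fun x y => adj y x)) : 0 ≤ pathWeight q l := by
  induction l with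
  | nil => simp [pathWeight]
  | cons a t ih =>
    cases t with
    | nil => simp [pathWeight]
    | cons c t =>
      rw [List.isChain_cons_cons] at h
      have := mul_nonneg (hq c a h.1) (ih h.2)
      simpa [pathWeight] using this

/-- If `Q` is row stochastic except for a zero row at `s`, the solution of `v = Qᵀ v + r`
has value `∑ r` at `s`. -/
theorem eq_sum_of_eq_transpose_mul_add {V : Type*} [Fintype V] {Q : V → V → ℝ} {s : V}
    (hs : ∀ j, Q s j = 0) (hsum : ∀ i, i ≠ s → ∑ j, Q i j = 1) {v r : V → ℝ}
    (hv : ∀ j, v j = ∑ i, Q i j * v i + r j) : v s = ∑ j, r j := by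
  classical
  have h : ∑ j, v j = ∑ i, (if i = s then 0 else v i) + ∑ j, r j := by
    rw [Finset.sum_congr rfl fun j _ => hv j, Finset.sum_add_distrib, Finset.sum_comm]
    congr 1
    refine Finset.sum_congr rfl fun i _ => ?_
    rw [← Finset.sum_mul]
    split_ifs with hi
    · simp [hi, hs]
    · rw [hsum i hi, one_mul]
  have h' : ∑ j, v j = ∑ i, (if i = s then 0 else v i) + v s := by
    rw [← Finset.sum_erase_add _ _ (Finset.mem_univ s),
      ← Finset.sum_erase_add Finset.univ (fun i => if i = s then 0 else v i)
        (Finset.mem_univ s)]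
    simp only [if_true, add_zero]
    congr 1
    exact Finset.sum_congr rfl fun i hi => (if_neg (Finset.ne_of_mem_erase hi)).symm
  linarith

/-- the backpropagation recursion
`ē_{N} = 1`, `e_{i,j} = ē_i q_{i,j}`, `ē_j = ∑_{i ∈ C_j} e_{i,j}` computes the
expected path-indicator matrix under the random-walk distribution
`p(Y) = ∏_{(i,j) ∈ Y} q_{i,j}`; in particular `p` is a probability distribution
on the set of paths from node `0` to node `N-1`, `E = ∑_Y p(Y) Y`, and `E` lies
in the convex hull of the set of path-indicator matrices. -/
theorem stmt18 (N : ℕ) (hN : 2 ≤ N)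
    (adj : Fin N → Fin N → Prop) [DecidableRel adj]
    (hadj : ∀ i j : Fin N, adj i j → j < i)
    (hpar : ∀ i : Fin N, i ≠ ⟨0, by omega⟩ → ∃ j, adj i j)
    (honly : ∀ j : Fin N, j ≠ ⟨N - 1, by omega⟩ → ∃ i, adj i j)
    (q : Fin N → Fin N → ℝ)
    (hq0 : ∀ i : Fin N, i ≠ ⟨0, by omega⟩ → ∀ j, 0 ≤ q i j)
    (hqsupp : ∀ i : Fin N, i ≠ ⟨0, by omega⟩ → ∀ j, ¬ adj i j → q i j = 0)
    (hqsum : ∀ i : Fin N, i ≠ ⟨0, by omega⟩ → ∑ j, q i j = 1)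
    (e : Fin N → Fin N → ℝ) (ebar : Fin N → ℝ)
    (hebarN : ebar ⟨N - 1, by omega⟩ = 1)
    (he : ∀ i j : Fin N, e i j = if adj i j then ebar i * q i j else 0)
    (hebar : ∀ j : Fin N, j ≠ ⟨N - 1, by omega⟩ → ebar j = ∑ i, e i j)
    (P : Finset (List (Fin N)))
    (hP : ∀ l : List (Fin N), l ∈ P ↔
      (l.head? = some ⟨0, by omega⟩ ∧ l.getLast? = some ⟨N - 1, by omega⟩ ∧
        l.Chain' (fun a b => adj b a))) :
    (∀ l ∈ P, 0 ≤ pathWeight q l) ∧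
    (∑ l ∈ P, pathWeight q l) = 1 ∧
    (∀ i j : Fin N, e i j = ∑ l ∈ P, pathWeight q l * edgeInd l i j) ∧
    (fun i j => e i j) ∈
      convexHull ℝ {Y : Fin N → Fin N → ℝ | ∃ l ∈ P, Y = fun i j => edgeInd l i j} := by
  set s : Fin N := ⟨0, by omega⟩
  set n : Fin N := ⟨N - 1, by omega⟩
  have hs : ∀ j, ¬ adj s j := fun j h => Nat.not_lt_zero _ (hadj s j h)
  have hn : ∀ i, ¬ adj i n := fun i h => by
    have h1 : N - 1 < i.val := hadj i n h
    omega
  have hne : ∀ i j, adj i j → i ≠ s := fun i j h hi => hs j (hi ▸ h)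
  set Q : Fin N → Fin N → ℝ := fun i j => if adj i j then q i j else 0 with hQ
  have hQs : ∀ j, Q s j = 0 := fun j => if_neg (hs j)
  have hQn : ∀ i, Q i n = 0 := fun i => if_neg (hn i)
  have hQsum : ∀ i, i ≠ s → ∑ j, Q i j = 1 := fun i hi => by
    rw [← hqsum i hi]
    refine Finset.sum_congr rfl fun j _ => ?_
    by_cases h : adj i j
    · simp [hQ, h]
    · simp [hQ, h, hqsupp i hi j h]
  let R : Fin N → Finset (List (Fin N)) := fun a => (IsPathFromTo.finite hadj a n).toFinset
  have hR : ∀ a l, l ∈ R a ↔ IsPathFromTo adj a n l := by simp [R]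
  have hPR : P = R s := by
    ext l
    rw [hP, hR]
    rfl
  have hRn : R n = {[n]} := by
    ext l
    rw [hR, IsPathFromTo.self_iff hn, Finset.mem_singleton]
  set W : Fin N → ℝ := fun a => ∑ l ∈ R a, pathWeight q l with hW
  have hWn : W n = 1 := by simp [hW, hRn, pathWeight]
  have hWrec : ∀ a, a ≠ n → W a = ∑ c, Q c a * W c := fun a ha => by
    rw [hW]
    simp only
    rw [IsPathFromTo.sum_eq hR ha]
    refine Finset.sum_congr rfl fun c _ => ?_
    by_cases h : adj c a
    · simp only [hQ, h, if_true, Finset.mul_sum]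
      exact Finset.sum_congr rfl fun l hl => pathWeight_cons q ((hR c l).1 hl)
    · simp [hQ, h]
  have hWs : W s = 1 := by
    have := eq_sum_of_eq_transpose_mul_add hQs hQsum (v := W)
      (r := fun a => if a = n then 1 else 0) fun a => by
        by_cases ha : a = n
        · simp [ha, hWn, hQn]
        · simp [ha, ← hWrec a ha]
    simpa using this
  have hebarW : ∀ a, ebar a = W a := by
    intro a
    induction a using WellFoundedGT.induction with
    | _ a ih =>
    by_cases ha : a = n
    · rw [ha, hebarN, hWn]
    · rw [hebar a ha, hWrec a ha]
      refine Finset.sum_congr rfl fun c _ => ?_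
      rw [he]
      by_cases h : adj c a
      · simp [hQ, h, ih c (hadj c a h), mul_comm]
      · simp [hQ, h]
  have hnonneg : ∀ l ∈ P, 0 ≤ pathWeight q l := fun l hl =>
    pathWeight_nonneg (fun i j h => hq0 i (hne i j h) j) ((hP l).1 hl).2.2
  have hE : ∀ i j, e i j = ∑ l ∈ P, pathWeight q l * edgeInd l i j := by
    intro i j
    set F : Fin N → ℝ := fun a => ∑ l ∈ R a, pathWeight q l * edgeInd l i j with hF
    have hFrec : ∀ a, F a = ∑ c, Q c a * F c + if a = j then Q i a * W i else 0 := by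
      intro a
      by_cases ha : a = n
      · simp [ha, hQn, hF, hRn, edgeInd]
      have hstep : F a = ∑ c, (Q c a * F c + if a = j ∧ c = i then Q c a * W c else 0) := by
        rw [hF]
        simp only
        rw [IsPathFromTo.sum_eq hR ha]
        refine Finset.sum_congr rfl fun c _ => ?_
        by_cases h : adj c a
        · have hterm : ∀ l ∈ R c, pathWeight q (a :: l) * edgeInd (a :: l) i j =
              q c a * (pathWeight q l * edgeInd l i j) +
                if a = j ∧ c = i then q c a * pathWeight q l else 0 := fun l hl => by
            rw [pathWeight_cons q ((hR c l).1 hl), edgeInd_cons hadj ((hR c l).1 hl) h]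
            split_ifs <;> ring
          rw [if_pos h, Finset.sum_congr rfl hterm, Finset.sum_add_distrib, ← Finset.mul_sum]
          simp only [hQ, h, if_true, hW]
          split_ifs <;> simp [Finset.mul_sum]
        · simp [hQ, h]
      rw [hstep, Finset.sum_add_distrib]
      by_cases hj : a = j <;> simp [hj]
    have hFs : F s = Q i j * W i := by
      rw [eq_sum_of_eq_transpose_mul_add hQs hQsum hFrec]
      simp
    rw [hPR, he, hebarW]
    refine Eq.trans ?_ hFs.symm
    simp only [hQ]
    split_ifs <;> ring
  have hone : ∑ l ∈ P, pathWeight q l = 1 := hPR ▸ hWs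
  refine ⟨hnonneg, hone, hE, ?_⟩
  have hcomb : (fun i j => e i j) = ∑ l ∈ P, pathWeight q l • fun i j => edgeInd l i j := by
    ext i j
    simp [hE, Finset.sum_apply]
  rw [hcomb]
  exact (convex_convexHull ℝ _).sum_mem hnonneg hone fun l hl =>
    subset_convexHull ℝ _ ⟨l, hl, rfl⟩
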